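/- Let 0 < a < b, let ω > 0 and let N be a real number with N > 10^7·(ω + 7), and set η = ω(b−a)/N. Let f, g : [a, b+η] → ℝ be continuous, let 0 < c ≤ 1, and set f₁(y) = f(y) − g(y)·M₂(f). Assume: (i) M₁(f) ≥ c·M₂(f); (ii) |g(y)| ≤ 2⁻⁵·c² for all y ∈ [a, b+η]; (iii) J(f₁, η) := (1/(b−a))·∫_a^b |∫_0^η f₁(y+v) dv| dy < (1/16)·c³·η·M₂(f). Then the zero set {y ∈ [a,b] : f₁(y) = 0} contains at least c²·N/(10(ω+2)) points, i.e. there is a finite subset S of [a,b] on which f₁ vanishes with card(S) ≥ c²·N/(10(ω+2)). -/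

import Mathlib

open Real MeasureTheory intervalIntegral

/-- A continuous function without zeros on `(x, y)` has constant sign there. -/
lemma abs_integral_eq_integral_abs_of_ne_zero {h : ℝ → ℝ} (hh : Continuous h) {x y : ℝ}
    (hxy : x ≤ y) (hz : ∀ t ∈ Set.Ioo x y, h t ≠ 0) :
    |∫ t in x..y, h t| = ∫ t in x..y, |h t| := by
  have hsign : (∀ t ∈ Set.Ioo x y, 0 ≤ h t) ∨ (∀ t ∈ Set.Ioo x y, h t ≤ 0) := by
    by_contra! hcon
    obtain ⟨⟨u, hu, hu0⟩, v, hv, hv0⟩ := hcon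
    obtain ⟨w, hw, hw0⟩ :=
      isPreconnected_Ioo.intermediate_value hu hv hh.continuousOn ⟨hu0.le, hv0.le⟩
    exact hz w hw hw0
  simp only [integral_of_le hxy, integral_Ioc_eq_integral_Ioo]
  rcases hsign with hs | hs
  · rw [abs_of_nonneg (setIntegral_nonneg measurableSet_Ioo hs)]
    exact setIntegral_congr_fun measurableSet_Ioo fun t ht => (abs_of_nonneg (hs t ht)).symm
  · rw [abs_of_nonpos (setIntegral_nonpos measurableSet_Ioo hs), ← MeasureTheory.integral_neg]
    exact setIntegral_congr_fun measurableSet_Ioo fun t ht => (abs_of_nonpos (hs t ht)).symm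

/-- The integral of a continuous function over a sliding window is continuous. -/
lemma continuous_window_integral {h : ℝ → ℝ} (hh : Continuous h) (η : ℝ) :
    Continuous fun y => ∫ t in y..(y + η), h t := by
  have hF : Continuous fun y => ∫ t in (0 : ℝ)..y, h t :=
    intervalIntegral.continuous_primitive (fun _ _ => hh.intervalIntegrable _ _) 0
  have hdiff : (fun y => ∫ t in y..(y + η), h t) =
      fun y => (∫ t in (0 : ℝ)..(y + η), h t) - ∫ t in (0 : ℝ)..y, h t := by
    funext y
    rw [integral_interval_sub_left] <;> exact hh.intervalIntegrable _ _
  rw [hdiff]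
  exact (hF.comp (continuous_add_const η)).sub hF

/-- If every point of `U` lies in the window `[y, y + η]` for a set of good `y` of length at
least `s`, then the window integrals over good `y` control `s` times the integral over `U`. -/
lemma mul_setIntegral_abs_le_setIntegral_window {h : ℝ → ℝ} (hh : Continuous h) {a b s η : ℝ}
    (hs : 0 ≤ s) (hη : 0 ≤ η) {G U : Set ℝ} (hG : G ⊆ Set.Icc a b)
    (hU : U ⊆ Set.Icc a b)
    (hwin : ∀ t ∈ U, ∃ α, Set.Icc α (α + s) ⊆ G ∩ Set.Icc (t - η) t) (hUm : MeasurableSet U) :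
    s * ∫ t in U, |h t| ≤ ∫ y in G, ∫ t in y..(y + η), |h t| := by
  have hcont := continuous_window_integral hh.abs η
  have hnonneg : ∀ y, 0 ≤ ∫ t in y..(y + η), |h t| := fun y =>
    integral_nonneg (by linarith) fun _ _ => abs_nonneg _
  have hintG : IntegrableOn (fun y => ∫ t in y..(y + η), |h t|) G :=
    (hcont.continuousOn.integrableOn_Icc (a := a) (b := b)).mono_set hG
  have hintU : IntegrableOn (fun t => |h t|) U :=
    (hh.abs.continuousOn.integrableOn_Icc (a := a) (b := b)).mono_set hU
  rw [← ENNReal.ofReal_le_ofReal_iff (integral_nonneg hnonneg), ENNReal.ofReal_mul hs,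
    ofReal_integral_eq_lintegral_ofReal hintU (ae_of_all _ fun _ => abs_nonneg _),
    ofReal_integral_eq_lintegral_ofReal hintG (ae_of_all _ hnonneg)]
  set D : Set (ℝ × ℝ) := {p | p.1 ≤ p.2 ∧ p.2 ≤ p.1 + η} with hD
  have hDm : MeasurableSet D :=
    (measurableSet_le measurable_fst measurable_snd).inter
      (measurableSet_le measurable_snd (measurable_fst.add_const η))
  set K : ℝ → ℝ → ENNReal := fun y t => D.indicator (fun p => ENNReal.ofReal |h p.2|) (y, t)
    with hK
  have hKm : Measurable (Function.uncurry K) :=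
    (((hh.measurable.comp measurable_snd).abs).ennreal_ofReal).indicator hDm
  have hrow : ∀ y, ENNReal.ofReal (∫ t in y..(y + η), |h t|) = ∫⁻ t, K y t := by
    intro y
    rw [integral_of_le (by linarith), ← integral_Icc_eq_integral_Ioc,
      ofReal_integral_eq_lintegral_ofReal hh.abs.continuousOn.integrableOn_Icc
        (ae_of_all _ fun _ => abs_nonneg _), ← lintegral_indicator measurableSet_Icc]
    rfl
  simp_rw [hrow]
  rw [lintegral_lintegral_swap hKm.aemeasurable, ← lintegral_const_mul _ (by fun_prop)]
  refine (setLIntegral_mono' hUm fun t ht => ?_).trans (setLIntegral_le_lintegral U _)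
  obtain ⟨α, hα⟩ := hwin t ht
  calc ENNReal.ofReal s * ENNReal.ofReal |h t|
      = ∫⁻ _ in Set.Icc α (α + s), ENNReal.ofReal |h t| := by
        rw [setLIntegral_const, Real.volume_Icc, mul_comm]; simp
    _ ≤ ∫⁻ y in Set.Icc α (α + s), K y t := by
        refine setLIntegral_mono' measurableSet_Icc fun y hy => ?_
        have h1 := (hα hy).2
        have : (y, t) ∈ D := ⟨h1.2, by linarith [h1.1]⟩
        simp [hK, this]
    _ ≤ ∫⁻ y in G, K y t := lintegral_mono_set fun y hy => (hα hy).1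

/-- Removing a set of measure at most `3 c² (b - a) / 5` costs only part of the mean of `|f|`. -/
lemma le_setIntegral_abs_sub_of_volume_le {f k : ℝ → ℝ} (hf : Continuous f) (hk : Continuous k)
    {a b c M : ℝ} (hab : a < b) (hc0 : 0 < c) (hc1 : c ≤ 1) (hM : 0 < M)
    (hL1 : c * M * (b - a) ≤ ∫ y in Set.Icc a b, |f y|)
    (hL2 : ∫ y in Set.Icc a b, |f y| ^ 2 ≤ M ^ 2 * (b - a))
    (hk1 : ∀ y ∈ Set.Icc a b, |f y| - c ^ 2 / 32 * M ≤ |k y|)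
    {T : Set ℝ} (hT : MeasurableSet T) (hvol : volume.real T ≤ 3 / 5 * c ^ 2 * (b - a))
    (hfin : volume T ≠ ⊤) :
    19 / 100 * c * M * (b - a) ≤ ∫ y in Set.Icc a b \ T, |k y| := by
  have hd : 0 < b - a := sub_pos.2 hab
  have hi1 : IntegrableOn (fun y => |f y|) (Set.Icc a b) := hf.abs.continuousOn.integrableOn_Icc
  have hi2 : IntegrableOn (fun y => |f y| ^ 2) (Set.Icc a b) :=
    (hf.abs.pow 2).continuousOn.integrableOn_Icc
  have hi3 : IntegrableOn (fun y => |k y|) (Set.Icc a b) := hk.abs.continuousOn.integrableOn_Icc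
  have hiT : Integrable (T.indicator fun _ => 5 / 8 * (M / c)) (volume.restrict (Set.Icc a b)) :=
    ((integrable_indicator_iff hT).2 (integrableOn_const hfin)).integrableOn
  have hiA : Integrable (fun y => |f y| - c ^ 2 / 32 * M) (volume.restrict (Set.Icc a b)) :=
    hi1.sub (integrable_const _)
  have hiB : Integrable (fun y => 2 / 5 * c / M * |f y| ^ 2) (volume.restrict (Set.Icc a b)) :=
    hi2.const_mul _
  have hiC : Integrable (fun y => |f y| - c ^ 2 / 32 * M - 2 / 5 * c / M * |f y| ^ 2)
      (volume.restrict (Set.Icc a b)) := hiA.sub hiB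
  have hiU : IntegrableOn (fun y => |f y| - c ^ 2 / 32 * M - 2 / 5 * c / M * |f y| ^ 2
      - T.indicator (fun _ => 5 / 8 * (M / c)) y) (Set.Icc a b) :=
    hiC.sub hiT
  have hIT : ∫ y in Set.Icc a b, T.indicator (fun _ => 5 / 8 * (M / c)) y
      ≤ 5 / 8 * (M / c) * (3 / 5 * c ^ 2 * (b - a)) := by
    rw [MeasureTheory.integral_indicator hT, MeasureTheory.integral_const, smul_eq_mul, mul_comm]
    refine mul_le_mul_of_nonneg_left (le_trans ?_ hvol) (by positivity)
    simp only [measureReal_def]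
    rw [Measure.restrict_apply_univ]
    exact ENNReal.toReal_mono hfin (Measure.restrict_apply_le _ _)
  have hkey : ∫ y in Set.Icc a b, (|f y| - c ^ 2 / 32 * M - 2 / 5 * c / M * |f y| ^ 2
      - T.indicator (fun _ => 5 / 8 * (M / c)) y) ≤ ∫ y in Set.Icc a b \ T, |k y| := by
    rw [Set.sdiff_eq, Set.inter_comm, ← Measure.restrict_restrict hT.compl,
      ← MeasureTheory.integral_indicator hT.compl]
    refine setIntegral_mono_on hiU (hi3.indicator hT.compl) measurableSet_Icc fun y hy => ?_
    have hk2 := hk1 y hy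
    have hsq : 0 ≤ 2 / 5 * c / M * |f y| ^ 2 := by positivity
    by_cases hyT : y ∈ T
    · have hamgm : |f y| ≤ 2 / 5 * c / M * |f y| ^ 2 + 5 / 8 * (M / c) := by
        have : 2 / 5 * c / M * |f y| ^ 2 + 5 / 8 * (M / c) - |f y|
            = 2 / 5 * c / M * (|f y| - 5 / 4 * (M / c)) ^ 2 := by
          field_simp; ring
        have h2 : 0 ≤ 2 / 5 * c / M * (|f y| - 5 / 4 * (M / c)) ^ 2 := by positivity
        linarith
      have : 0 ≤ c ^ 2 / 32 * M := by positivity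
      simp only [hyT, Set.indicator_of_mem, Set.mem_compl_iff, not_true_eq_false,
        not_false_eq_true, Set.indicator_of_notMem]
      linarith
    · simp only [hyT, Set.indicator_of_mem, Set.mem_compl_iff,
        not_false_eq_true, Set.indicator_of_notMem]
      linarith
  refine le_trans ?_ hkey
  rw [MeasureTheory.integral_sub hiC hiT, MeasureTheory.integral_sub hiA hiB,
    MeasureTheory.integral_sub hi1 (integrable_const _),
    MeasureTheory.integral_const_mul (2 / 5 * c / M)]
  have hconst : ∫ _ in Set.Icc a b, c ^ 2 / 32 * M = (b - a) * (c ^ 2 / 32 * M) := by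
    simp [measureReal_def, hd.le]
  rw [hconst]
  have h2 : 2 / 5 * c / M * ∫ y in Set.Icc a b, |f y| ^ 2 ≤ 2 / 5 * c / M * (M ^ 2 * (b - a)) :=
    mul_le_mul_of_nonneg_left hL2 (by positivity)
  have e2 : 2 / 5 * c / M * (M ^ 2 * (b - a)) = 2 / 5 * (c * M * (b - a)) := by field_simp
  have e3 : 5 / 8 * (M / c) * (3 / 5 * c ^ 2 * (b - a)) = 3 / 8 * (c * M * (b - a)) := by
    field_simp
  have e4 : (b - a) * (c ^ 2 / 32 * M) ≤ 1 / 32 * (c * M * (b - a)) := by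
    have : 0 ≤ c * M * (b - a) * (1 - c) := by
      have : 0 ≤ 1 - c := by linarith
      positivity
    nlinarith
  have : 0 < c * M * (b - a) := by positivity
  linarith

/-- Lower bound for the mean absolute window integral of a function with few zeros. -/
lemma mul_le_setIntegral_abs_window {f k : ℝ → ℝ} (hf : Continuous f) (hk : Continuous k)
    {a b c M s η : ℝ} (hab : a < b) (hc0 : 0 < c) (hc1 : c ≤ 1) (hM : 0 < M)
    (hL1 : c * M * (b - a) ≤ ∫ y in Set.Icc a b, |f y|)
    (hL2 : ∫ y in Set.Icc a b, |f y| ^ 2 ≤ M ^ 2 * (b - a))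
    (hk1 : ∀ y ∈ Set.Icc a b, |f y| - c ^ 2 / 32 * M ≤ |k y|)
    (hs : 0 < s) (hsη : s ≤ η) (hsL : s + η ≤ b - a) (Z : Finset ℝ)
    (hZ : ∀ y ∈ Set.Icc a b, k y = 0 → y ∈ Z) (hZs : Z = ∅ ∨ s = η)
    (hcard : (2 * (Z.card : ℝ) + 4) * s ≤ 3 / 5 * c ^ 2 * (b - a)) :
    s * (19 / 100 * c * M * (b - a)) ≤ ∫ y in Set.Icc a b, |∫ t in y..(y + η), k t| := by
  set Z' : Finset ℝ := insert a (insert b Z) with hZ'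
  set T : Set ℝ := ⋃ z ∈ Z', Set.Ioo (z - s) (z + s) with hTdef
  have hT : MeasurableSet T := Z'.measurableSet_biUnion fun _ _ => measurableSet_Ioo
  have hvolT : volume T ≤ ENNReal.ofReal ((2 * (Z.card : ℝ) + 4) * s) := by
    have hc : (Z'.card : ℝ) ≤ Z.card + 2 := by
      have h1 := Finset.card_insert_le a (insert b Z)
      have h2 := Finset.card_insert_le b Z
      exact_mod_cast h1.trans (Nat.succ_le_succ h2)
    calc volume T ≤ ∑ z ∈ Z', volume (Set.Ioo (z - s) (z + s)) := measure_biUnion_finset_le _ _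
      _ = ∑ z ∈ Z', ENNReal.ofReal (2 * s) := by
          refine Finset.sum_congr rfl fun z _ => ?_
          rw [Real.volume_Ioo]; congr 1; ring
      _ = ENNReal.ofReal (Z'.card * (2 * s)) := by
          rw [Finset.sum_const, nsmul_eq_mul, ENNReal.ofReal_mul (Nat.cast_nonneg _),
            ENNReal.ofReal_natCast]
      _ ≤ _ := ENNReal.ofReal_le_ofReal (by nlinarith)
  have hfin : volume T ≠ ⊤ := ne_top_of_le_ne_top ENNReal.ofReal_ne_top hvolT
  have hvol : volume.real T ≤ 3 / 5 * c ^ 2 * (b - a) :=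
    (ENNReal.toReal_le_of_le_ofReal (by positivity) hvolT).trans hcard
  have hTmem : ∀ t, t ∉ T → ∀ z ∈ Z', t ≤ z - s ∨ z + s ≤ t := by
    intro t ht z hz
    by_contra! hcon
    exact ht (Set.mem_biUnion hz hcon)
  set G : Set ℝ := Set.Icc a (b - η) \ ⋃ z ∈ Z, Set.Ioo (z - η) z with hGdef
  have hGm : MeasurableSet G :=
    measurableSet_Icc.diff (Z.measurableSet_biUnion fun _ _ => measurableSet_Ioo)
  have hG : G ⊆ Set.Icc a b := fun y hy => ⟨hy.1.1, by linarith [hy.1.2]⟩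
  have hη : 0 < η := hs.trans_le hsη
  have hwin : ∀ t ∈ Set.Icc a b \ T,
      ∃ α, Set.Icc α (α + s) ⊆ G ∩ Set.Icc (t - η) t := by
    rintro t ⟨⟨hta, htb⟩, htT⟩
    have h1 : a + s ≤ t := by
      rcases hTmem t htT a (by simp [hZ']) with h | h <;> linarith
    have h2 : t ≤ b - s := by
      rcases hTmem t htT b (by simp [hZ']) with h | h <;> linarith
    refine ⟨max a (t - η), fun y hy => ?_⟩
    have hya : a ≤ y := (le_max_left _ _).trans hy.1
    have hyt : t - η ≤ y := (le_max_right _ _).trans hy.1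
    have hy1 : y ≤ t := hy.2.trans (by rcases max_cases a (t - η) with h | h <;> linarith)
    have hy2 : y ≤ b - η := hy.2.trans (by rcases max_cases a (t - η) with h | h <;> linarith)
    refine ⟨⟨⟨hya, hy2⟩, fun hmem => ?_⟩, hyt, hy1⟩
    obtain ⟨z, hz, hz1, hz2⟩ := Set.mem_iUnion₂.1 hmem
    rcases hZs with h0 | h0
    · simp [h0] at hz
    · rcases hTmem t htT z (by simp [hZ', hz]) with h | h <;> linarith
  have hGabs : ∀ y ∈ G, |∫ t in y..(y + η), k t| = ∫ t in y..(y + η), |k t| := by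
    intro y hy
    refine abs_integral_eq_integral_abs_of_ne_zero hk (by linarith) fun t ht ht0 => hy.2 ?_
    have hy1 := hy.1.1
    have hy2 := hy.1.2
    exact Set.mem_biUnion (hZ t ⟨by linarith [ht.1], by linarith [ht.2]⟩ ht0)
      ⟨by linarith [ht.2], ht.1⟩
  have hcont := (continuous_window_integral hk η).abs
  calc s * (19 / 100 * c * M * (b - a))
      ≤ s * ∫ y in Set.Icc a b \ T, |k y| := mul_le_mul_of_nonneg_left
        (le_setIntegral_abs_sub_of_volume_le hf hk hab hc0 hc1 hM hL1 hL2 hk1 hT hvol hfin) hs.le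
    _ ≤ ∫ y in G, ∫ t in y..(y + η), |k t| :=
        mul_setIntegral_abs_le_setIntegral_window hk hs.le hη.le hG Set.sdiff_subset hwin
          (measurableSet_Icc.diff hT)
    _ = ∫ y in G, |∫ t in y..(y + η), k t| :=
        (setIntegral_congr_fun hGm hGabs).symm
    _ ≤ ∫ y in Set.Icc a b, |∫ t in y..(y + η), k t| :=
        setIntegral_mono_set hcont.continuousOn.integrableOn_Icc
          (ae_of_all _ fun _ => abs_nonneg _) hG.eventuallyLE

/-- Modified Littlewood theorem: lower bound on the number of zeros of
`f₁ = f - g · M₂(f)` on `[a, b]`. -/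
theorem littlewood_zero_count
    (a b ω N c η M₁ M₂ : ℝ) (f g f₁ : ℝ → ℝ)
    (ha : 0 < a) (hab : a < b)
    (hω : 0 < ω) (hN : N > 10 ^ 7 * (ω + 7))
    (hη : η = ω * (b - a) / N)
    (hf : ContinuousOn f (Set.Icc a (b + η)))
    (hg : ContinuousOn g (Set.Icc a (b + η)))
    (hc0 : 0 < c) (hc1 : c ≤ 1)
    (hM₁ : M₁ = (1 / (b - a)) * ∫ y in a..b, |f y|)
    (hM₂ : M₂ = Real.sqrt ((1 / (b - a)) * ∫ y in a..b, |f y| ^ 2))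
    (hf₁ : ∀ y, f₁ y = f y - g y * M₂)
    (hM : M₁ ≥ c * M₂)
    (hgb : ∀ y ∈ Set.Icc a (b + η), |g y| ≤ ((2 : ℝ) ^ 5)⁻¹ * c ^ 2)
    (hJ : (1 / (b - a)) * (∫ y in a..b, |∫ v in (0:ℝ)..η, f₁ (y + v)|)
        < (1 / 16) * c ^ 3 * η * M₂) :
    ∃ S : Finset ℝ, ↑S ⊆ Set.Icc a b ∧ (∀ y ∈ S, f₁ y = 0) ∧
      (S.card : ℝ) ≥ c ^ 2 * N / (10 * (ω + 2)) := by
  have hd : 0 < b - a := sub_pos.2 hab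
  have hN0 : 0 < N := by linarith
  have hη0 : 0 < η := by rw [hη]; positivity
  have hηN : η * N = ω * (b - a) := by rw [hη]; field_simp
  have hηL : η ≤ (b - a) / 10 ^ 7 := by
    rw [hη, div_le_div_iff₀ hN0 (by positivity)]
    nlinarith
  have hJ0 : 0 ≤ (1 / (b - a)) * (∫ y in a..b, |∫ v in (0:ℝ)..η, f₁ (y + v)|) :=
    mul_nonneg (by positivity) (integral_nonneg hab.le fun _ _ => abs_nonneg _)
  have hM0 : 0 < M₂ := by
    have : 0 < (1 / 16) * c ^ 3 * η * M₂ := hJ0.trans_lt hJ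
    exact (pos_iff_pos_of_mul_pos this).1 (by positivity)
  by_contra! hcon
  have hfinite : (Set.Icc a b ∩ {y | f₁ y = 0}).Finite := by
    by_contra hinf
    obtain ⟨S, hS, hScard⟩ :=
      Set.Infinite.exists_subset_card_eq hinf ⌈c ^ 2 * N / (10 * (ω + 2))⌉₊
    have hlt := hcon S (fun y hy => (hS hy).1) fun y hy => (hS hy).2
    rw [hScard] at hlt
    exact absurd (Nat.le_ceil _) (not_le.2 hlt)
  set Z := hfinite.toFinset with hZdef
  have hcardZ : (Z.card : ℝ) < c ^ 2 * N / (10 * (ω + 2)) :=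
    hcon Z (fun y hy => ((hfinite.mem_toFinset).1 hy).1) fun y hy =>
      ((hfinite.mem_toFinset).1 hy).2
  have hle : a ≤ b + η := by linarith
  set F : ℝ → ℝ := Set.IccExtend hle ((Set.Icc a (b + η)).domRestrict f) with hF
  set k : ℝ → ℝ := Set.IccExtend hle ((Set.Icc a (b + η)).domRestrict f₁) with hk
  have hFc : Continuous F := (continuousOn_iff_continuous_domRestrict.1 hf).Icc_extend'
  have hkc : Continuous k := by
    have : ContinuousOn f₁ (Set.Icc a (b + η)) := by
      rw [funext hf₁]
      exact hf.sub (hg.mul continuousOn_const)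
    exact (continuousOn_iff_continuous_domRestrict.1 this).Icc_extend'
  have hFeq : ∀ y ∈ Set.Icc a (b + η), F y = f y := fun y hy => by
    rw [hF, Set.IccExtend_of_mem hle _ hy]; rfl
  have hkeq : ∀ y ∈ Set.Icc a (b + η), k y = f₁ y := fun y hy => by
    rw [hk, Set.IccExtend_of_mem hle _ hy]; rfl
  have hsub : ∀ y ∈ Set.Icc a b, y ∈ Set.Icc a (b + η) := fun y hy => ⟨hy.1, by linarith [hy.2]⟩
  have hI1 : ∫ y in Set.Icc a b, |F y| = M₁ * (b - a) := by
    rw [hM₁, integral_of_le hab.le, ← integral_Icc_eq_integral_Ioc,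
      setIntegral_congr_fun measurableSet_Icc fun y hy => by rw [hFeq y (hsub y hy)]]
    field_simp
  have hI2 : ∫ y in Set.Icc a b, |F y| ^ 2 = M₂ ^ 2 * (b - a) := by
    rw [hM₂, Real.sq_sqrt (mul_nonneg (by positivity)
      (integral_nonneg hab.le fun _ _ => by positivity)), integral_of_le hab.le,
      ← integral_Icc_eq_integral_Ioc,
      setIntegral_congr_fun measurableSet_Icc fun y hy => by rw [hFeq y (hsub y hy)]]
    field_simp
  have hIJ : ∫ y in Set.Icc a b, |∫ t in y..(y + η), k t|
      = ∫ y in a..b, |∫ v in (0:ℝ)..η, f₁ (y + v)| := by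
    rw [integral_of_le hab.le, ← integral_Icc_eq_integral_Ioc]
    refine setIntegral_congr_fun measurableSet_Icc fun y hy => ?_
    simp only [intervalIntegral.integral_comp_add_left, add_zero]
    congr 1
    refine integral_congr fun t ht => hkeq t ?_
    rw [Set.uIcc_of_le (by linarith)] at ht
    exact ⟨hy.1.trans ht.1, ht.2.trans (by linarith [hy.2])⟩
  have hk1 : ∀ y ∈ Set.Icc a b, |F y| - c ^ 2 / 32 * M₂ ≤ |k y| := by
    intro y hy
    rw [hFeq y (hsub y hy), hkeq y (hsub y hy), hf₁]
    have h1 := abs_sub_abs_le_abs_sub (f y) (g y * M₂)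
    rw [abs_mul, abs_of_pos hM0] at h1
    have h2 := mul_le_mul_of_nonneg_right (hgb y (hsub y hy)) hM0.le
    norm_num at h2
    linarith
  have hcardη : (Z.card : ℝ) * η ≤ c ^ 2 * (b - a) / 10 := by
    rw [lt_div_iff₀ (by positivity)] at hcardZ
    have h1 : (Z.card : ℝ) * (10 * ω) ≤ c ^ 2 * N := by
      nlinarith [(Nat.cast_nonneg Z.card : (0 : ℝ) ≤ _)]
    have h2 := mul_le_mul_of_nonneg_right h1 hd.le
    have h3 : (Z.card : ℝ) * η * N ≤ c ^ 2 * (b - a) / 10 * N := by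
      calc (Z.card : ℝ) * η * N = Z.card * (η * N) := by ring
        _ ≤ _ := by rw [hηN]; linarith
    exact le_of_mul_le_mul_right h3 hN0
  set s := min η (c ^ 2 * (b - a) / 10) with hsdef
  have hs0 : 0 < s := lt_min hη0 (by positivity)
  have hsη : s ≤ η := min_le_left _ _
  have hsc : s ≤ c ^ 2 * (b - a) / 10 := min_le_right _ _
  have hZs : Z = ∅ ∨ s = η := by
    rcases Z.eq_empty_or_nonempty with h | h
    · exact Or.inl h
    · have : (1 : ℝ) ≤ Z.card := by exact_mod_cast h.card_pos
      exact Or.inr (min_eq_left (by nlinarith))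
  have hcard : (2 * (Z.card : ℝ) + 4) * s ≤ 3 / 5 * c ^ 2 * (b - a) := by
    have : (Z.card : ℝ) * s ≤ Z.card * η := mul_le_mul_of_nonneg_left hsη (Nat.cast_nonneg _)
    linarith
  have hZ : ∀ y ∈ Set.Icc a b, k y = 0 → y ∈ Z := fun y hy h0 =>
    hfinite.mem_toFinset.2 ⟨hy, by rw [← h0]; exact (hkeq y (hsub y hy)).symm⟩
  have hmain := mul_le_setIntegral_abs_window hFc hkc hab hc0 hc1 hM0
    (by rw [hI1]; exact mul_le_mul_of_nonneg_right hM hd.le) hI2.le hk1 hs0 hsη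
    (by linarith) Z hZ hZs hcard
  rw [hIJ] at hmain
  rw [one_div_mul_eq_div, div_lt_iff₀ hd] at hJ
  have hX : 0 < c * M₂ * (b - a) := by positivity
  have hlt : s * (19 / 100) < 1 / 16 * c ^ 2 * η := by
    refine lt_of_mul_lt_mul_right ?_ hX.le
    linarith
  have hc2 : c ^ 2 ≤ 1 := pow_le_one₀ hc0.le hc1
  rcases min_choice η (c ^ 2 * (b - a) / 10) with h | h
  · rw [hsdef, h] at hlt
    nlinarith
  · rw [hsdef, h] at hlt
    have : 0 < c ^ 2 := by positivity
    nlinarith
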